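/- Let {Π_{ik}} be a complete measurement design on ℂ^q, and for each i let Ω_i ∈ ℝ^{q_i×q_i} be a symmetric positive definite matrix (as holds when [Ω_i]_{kk'} = |K(λ_{ik},λ_{ik'})|² for a kernel whose squared modulus is strictly positive definite, evaluated at distinct spectral points). Let p_{ik} ∈ ℝ be given, and define H_K[S] := (1/n) Σ_i Σ_{k,k'} [Ω_i]_{kk'} tr(S Π_{ik}) Π_{ik'}, P_K := (1/n) Σ_i Σ_{k,k'} [Ω_i]_{kk'} p_{ik} Π_{ik'}, and Loss_K[S] := Σ_{i=1}^n Σ_{k,k'=1}^{q_i} [Ω_i]_{kk'} (tr(SΠ_{ik}) − p_{ik})(tr(SΠ_{ik'}) − p_{ik'}). Then H_K is a positive definite (hence invertible) self-adjoint operator on the real Hilbert space of Hermitian q×q matrices with the Frobenius inner product, tr(H_K^{-1}(I_q)) > 0, and the unique minimizer of Loss_K over Hermitian matrices of trace 1 is ρ̂ = H_K^{-1}(P_K) + (1 − tr(H_K^{-1}(P_K))) · H_K^{-1}(I_q)/tr(H_K^{-1}(I_q)). -/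

import Mathlib

open Matrix Finset

noncomputable section

/-- The kernel Gram superoperator `H_K[S] = (1/n) Σ_i Σ_{k,k'} [Ω_i]_{kk'} tr(S Π_{ik}) Π_{ik'}`. -/
def kernelGramOf {q n : ℕ} (out : Fin n → ℕ)
    (P : (i : Fin n) → Fin (out i) → Matrix (Fin q) (Fin q) ℂ)
    (Ω : (i : Fin n) → Matrix (Fin (out i)) (Fin (out i)) ℝ)
    (S : Matrix (Fin q) (Fin q) ℂ) : Matrix (Fin q) (Fin q) ℂ :=
  (n : ℂ)⁻¹ • ∑ i, ∑ k, ∑ k', ((Ω i k k' : ℝ) * (S * P i k).trace : ℂ) • P i k'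

/-- The effective data matrix `P_K = (1/n) Σ_i Σ_{k,k'} [Ω_i]_{kk'} p_{ik} Π_{ik'}`. -/
def kernelDataOf {q n : ℕ} (out : Fin n → ℕ)
    (P : (i : Fin n) → Fin (out i) → Matrix (Fin q) (Fin q) ℂ)
    (Ω : (i : Fin n) → Matrix (Fin (out i)) (Fin (out i)) ℝ)
    (p : (i : Fin n) → Fin (out i) → ℝ) : Matrix (Fin q) (Fin q) ℂ :=
  (n : ℂ)⁻¹ • ∑ i, ∑ k, ∑ k', ((Ω i k k' * p i k : ℝ) : ℂ) • P i k'

/-- The kernel loss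
`Loss_K[S] = Σ_i Σ_{k,k'} [Ω_i]_{kk'} (tr(SΠ_{ik}) − p_{ik})(tr(SΠ_{ik'}) − p_{ik'})`. -/
def kernelLossOf {q n : ℕ} (out : Fin n → ℕ)
    (P : (i : Fin n) → Fin (out i) → Matrix (Fin q) (Fin q) ℂ)
    (Ω : (i : Fin n) → Matrix (Fin (out i)) (Fin (out i)) ℝ)
    (p : (i : Fin n) → Fin (out i) → ℝ)
    (S : Matrix (Fin q) (Fin q) ℂ) : ℝ :=
  ∑ i, ∑ k, ∑ k', Ω i k k' *
    ((S * P i k).trace.re - p i k) * ((S * P i k').trace.re - p i k')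

/-- The real bilinear form `Σ_i Σ_{k,k'} [Ω_i]_{kk'} x_{ik} y_{ik'}`. -/
def kernelForm {n : ℕ} {out : Fin n → ℕ}
    (Ω : (i : Fin n) → Matrix (Fin (out i)) (Fin (out i)) ℝ)
    (x y : (i : Fin n) → Fin (out i) → ℝ) : ℝ :=
  ∑ i, ∑ k, ∑ k', Ω i k k' * x i k * y i k'

section kernelForm

variable {n : ℕ} {out : Fin n → ℕ} {Ω : (i : Fin n) → Matrix (Fin (out i)) (Fin (out i)) ℝ}

theorem kernelForm_comm (hΩ : ∀ i, (Ω i).IsSymm) (x y : (i : Fin n) → Fin (out i) → ℝ) :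
    kernelForm Ω x y = kernelForm Ω y x := by
  unfold kernelForm
  refine Finset.sum_congr rfl fun i _ => ?_
  rw [Finset.sum_comm]
  refine Finset.sum_congr rfl fun k _ => Finset.sum_congr rfl fun k' _ => ?_
  rw [(hΩ i).apply k k']
  ring

theorem kernelForm_add_left (x x' y : (i : Fin n) → Fin (out i) → ℝ) :
    kernelForm Ω (x + x') y = kernelForm Ω x y + kernelForm Ω x' y := by
  simp only [kernelForm, Pi.add_apply, mul_add, add_mul, Finset.sum_add_distrib]

theorem kernelForm_sub_left (x x' y : (i : Fin n) → Fin (out i) → ℝ) :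
    kernelForm Ω (x - x') y = kernelForm Ω x y - kernelForm Ω x' y := by
  simp only [kernelForm, Pi.sub_apply, mul_sub, sub_mul, Finset.sum_sub_distrib]

theorem kernelForm_add_right (x y y' : (i : Fin n) → Fin (out i) → ℝ) :
    kernelForm Ω x (y + y') = kernelForm Ω x y + kernelForm Ω x y' := by
  simp only [kernelForm, Pi.add_apply, mul_add, Finset.sum_add_distrib]

theorem kernelForm_self_eq (x : (i : Fin n) → Fin (out i) → ℝ) :
    kernelForm Ω x x = ∑ i, star (x i) ⬝ᵥ (Ω i *ᵥ x i) := by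
  simp only [kernelForm, dotProduct, mulVec, star_trivial, Finset.mul_sum]
  refine Finset.sum_congr rfl fun i _ => Finset.sum_congr rfl fun k _ =>
    Finset.sum_congr rfl fun k' _ => ?_
  ring

theorem kernelForm_self_pos (hΩ : ∀ i, (Ω i).PosDef) {x : (i : Fin n) → Fin (out i) → ℝ}
    (hx : x ≠ 0) : 0 < kernelForm Ω x x := by
  rw [kernelForm_self_eq]
  obtain ⟨i, hi⟩ := Function.ne_iff.mp hx
  exact Finset.sum_pos' (fun j _ => (hΩ j).posSemidef.dotProduct_mulVec_nonneg (x j))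
    ⟨i, Finset.mem_univ i, (hΩ i).dotProduct_mulVec_pos hi⟩

end kernelForm

theorem Matrix.IsHermitian.ofReal_re_trace {m : Type*} [Fintype m] {A : Matrix m m ℂ}
    (hA : A.IsHermitian) : (A.trace.re : ℂ) = A.trace := by
  refine Complex.conj_eq_iff_re.mp ?_
  rw [starRingEnd_apply, ← trace_conjTranspose, hA.eq]

theorem Matrix.IsHermitian.ofReal_re_trace_mul {m : Type*} [Fintype m] {A B : Matrix m m ℂ}
    (hA : A.IsHermitian) (hB : B.IsHermitian) : ((A * B).trace.re : ℂ) = (A * B).trace := by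
  refine Complex.conj_eq_iff_re.mp ?_
  rw [starRingEnd_apply, ← trace_conjTranspose, conjTranspose_mul, hA.eq, hB.eq, trace_mul_comm]

section Gram

variable {q n : ℕ} {out : Fin n → ℕ} {P : (i : Fin n) → Fin (out i) → Matrix (Fin q) (Fin q) ℂ}
  {Ω : (i : Fin n) → Matrix (Fin (out i)) (Fin (out i)) ℝ}

/-- The real parts of the outcome coefficients `tr(S Π_{ik})`. -/
def outcomeRe (P : (i : Fin n) → Fin (out i) → Matrix (Fin q) (Fin q) ℂ)
    (S : Matrix (Fin q) (Fin q) ℂ) (i : Fin n) (k : Fin (out i)) : ℝ :=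
  (S * P i k).trace.re

theorem outcomeRe_add (S T : Matrix (Fin q) (Fin q) ℂ) :
    outcomeRe P (S + T) = outcomeRe P S + outcomeRe P T := by
  ext i k
  simp [outcomeRe, add_mul]

theorem kernelLossOf_eq (p : (i : Fin n) → Fin (out i) → ℝ) (S : Matrix (Fin q) (Fin q) ℂ) :
    kernelLossOf out P Ω p S = kernelForm Ω (outcomeRe P S - p) (outcomeRe P S - p) := rfl

theorem trace_kernelGramOf_mul (hP : ∀ i k, (P i k).IsHermitian) {S T : Matrix (Fin q) (Fin q) ℂ}
    (hS : S.IsHermitian) (hT : T.IsHermitian) :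
    (kernelGramOf out P Ω S * T).trace =
      ((n : ℝ)⁻¹ * kernelForm Ω (outcomeRe P S) (outcomeRe P T) : ℝ) := by
  simp only [kernelGramOf, kernelForm, outcomeRe, smul_mul_assoc, trace_smul, Finset.sum_mul,
    trace_sum, smul_eq_mul]
  push_cast
  simp only [hS.ofReal_re_trace_mul (hP _ _), hT.ofReal_re_trace_mul (hP _ _),
    trace_mul_comm (P _ _) T]

theorem trace_kernelDataOf_mul (hP : ∀ i k, (P i k).IsHermitian)
    (p : (i : Fin n) → Fin (out i) → ℝ) {T : Matrix (Fin q) (Fin q) ℂ} (hT : T.IsHermitian) :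
    (kernelDataOf out P Ω p * T).trace =
      ((n : ℝ)⁻¹ * kernelForm Ω p (outcomeRe P T) : ℝ) := by
  simp only [kernelDataOf, kernelForm, outcomeRe, smul_mul_assoc, trace_smul, Finset.sum_mul,
    trace_sum, smul_eq_mul]
  push_cast
  simp only [hT.ofReal_re_trace_mul (hP _ _), trace_mul_comm (P _ _) T]

theorem kernelGramOf_conjTranspose (hP : ∀ i k, (P i k).IsHermitian)
    (S : Matrix (Fin q) (Fin q) ℂ) : kernelGramOf out P Ω Sᴴ = (kernelGramOf out P Ω S)ᴴ := by
  have h (i k) : (Sᴴ * P i k).trace = star (S * P i k).trace := by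
    rw [← trace_conjTranspose, conjTranspose_mul, (hP i k).eq, trace_mul_comm]
  simp [kernelGramOf, conjTranspose_sum, conjTranspose_smul, (hP _ _).eq, h]

theorem kernelDataOf_isHermitian (hP : ∀ i k, (P i k).IsHermitian)
    (p : (i : Fin n) → Fin (out i) → ℝ) : (kernelDataOf out P Ω p).IsHermitian := by
  simp [IsHermitian, kernelDataOf, conjTranspose_sum, conjTranspose_smul, (hP _ _).eq]

/-- The kernel Gram superoperator as a complex-linear map on all matrices. -/
def kernelGramLinear (P : (i : Fin n) → Fin (out i) → Matrix (Fin q) (Fin q) ℂ)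
    (Ω : (i : Fin n) → Matrix (Fin (out i)) (Fin (out i)) ℝ) :
    Matrix (Fin q) (Fin q) ℂ →ₗ[ℂ] Matrix (Fin q) (Fin q) ℂ where
  toFun := kernelGramOf out P Ω
  map_add' S T := by
    simp only [kernelGramOf, add_mul, trace_add, mul_add, add_smul, Finset.sum_add_distrib,
      smul_add]
  map_smul' c S := by
    simp only [kernelGramOf, smul_mul_assoc, trace_smul, smul_eq_mul, Finset.smul_sum, smul_smul,
      RingHom.id_apply]
    refine Finset.sum_congr rfl fun i _ => Finset.sum_congr rfl fun k _ =>
      Finset.sum_congr rfl fun k' _ => ?_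
    congr 1
    ring

theorem kernelGramLinear_apply (S : Matrix (Fin q) (Fin q) ℂ) :
    kernelGramLinear P Ω S = kernelGramOf out P Ω S := rfl

theorem re_trace_kernelGramOf_mul_self_pos (hn : 1 ≤ n) (hP : ∀ i k, (P i k).IsHermitian)
    (hsum : ∀ i, ∑ k, P i k = 1)
    (hcomplete : ∀ Δ : Matrix (Fin q) (Fin q) ℂ, Δ.IsHermitian → Δ.trace = 0 →
        (∀ i k, (Δ * P i k).trace = 0) → Δ = 0)
    (hΩ : ∀ i, (Ω i).PosDef) {S : Matrix (Fin q) (Fin q) ℂ} (hS : S.IsHermitian) (hS0 : S ≠ 0) :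
    0 < ((kernelGramOf out P Ω S * S).trace).re := by
  rw [trace_kernelGramOf_mul hP hS hS, Complex.ofReal_re]
  refine mul_pos (by positivity) (kernelForm_self_pos hΩ fun h => hS0 ?_)
  have h0 (i k) : (S * P i k).trace = 0 := by
    rw [← hS.ofReal_re_trace_mul (hP i k), Complex.ofReal_eq_zero]
    exact congrFun (congrFun h i) k
  refine hcomplete S hS ?_ h0
  rw [← mul_one S, ← hsum ⟨0, hn⟩, Finset.mul_sum, trace_sum]
  exact Finset.sum_eq_zero fun k _ => h0 _ k

theorem kernelGramLinear_injective (hP : ∀ i k, (P i k).IsHermitian)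
    (hpos : ∀ S : Matrix (Fin q) (Fin q) ℂ, S.IsHermitian → S ≠ 0 →
      0 < ((kernelGramOf out P Ω S * S).trace).re) :
    Function.Injective (kernelGramLinear P Ω) := by
  have hker (S : Matrix (Fin q) (Fin q) ℂ) (hS : S.IsHermitian)
      (h : kernelGramLinear P Ω S = 0) : S = 0 := by
    by_contra hS0
    have := hpos S hS hS0
    rw [← kernelGramLinear_apply, h] at this
    simp at this
  refine (injective_iff_map_eq_zero _).mpr fun S h => ?_
  have h' : kernelGramLinear P Ω Sᴴ = 0 := by
    rw [kernelGramLinear_apply, kernelGramOf_conjTranspose hP, ← kernelGramLinear_apply, h,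
      conjTranspose_zero]
  have h₁ : S + Sᴴ = 0 := hker _ (isHermitian_add_transpose_self S)
    (by rw [map_add, h, h', add_zero])
  have h₂ : Complex.I • (S - Sᴴ) = 0 := by
    refine hker _ ?_ (by rw [map_smul, map_sub, h, h', sub_zero, smul_zero])
    simp [IsHermitian, conjTranspose_smul, ← smul_neg]
  have h₃ : S - Sᴴ = 0 := (smul_eq_zero.mp h₂).resolve_left Complex.I_ne_zero
  have h₄ : (2 : ℂ) • S = 0 := by
    rw [two_smul]
    simpa using congrArg₂ (· + ·) h₁ h₃
  exact (smul_eq_zero.mp h₄).resolve_left two_ne_zero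

theorem exists_isHermitian_kernelGramOf_eq (hP : ∀ i k, (P i k).IsHermitian)
    (hpos : ∀ S : Matrix (Fin q) (Fin q) ℂ, S.IsHermitian → S ≠ 0 →
      0 < ((kernelGramOf out P Ω S * S).trace).re)
    {M : Matrix (Fin q) (Fin q) ℂ} (hM : M.IsHermitian) :
    ∃ A : Matrix (Fin q) (Fin q) ℂ, A.IsHermitian ∧ kernelGramOf out P Ω A = M := by
  have hinj := kernelGramLinear_injective hP hpos
  obtain ⟨A, hA⟩ := LinearMap.injective_iff_surjective.mp hinj M
  refine ⟨A, hinj ?_, hA⟩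
  rw [kernelGramLinear_apply, kernelGramOf_conjTranspose hP, ← kernelGramLinear_apply, hA, hM.eq]

/-- If `H_K[R] - P_K` is a multiple of the identity, the loss on the affine hyperplane of matrices
with the same trace as `R` exceeds the loss at `R` by `n ⟨H_K[Δ], Δ⟩`. -/
theorem kernelLossOf_add (hn : 1 ≤ n) (hP : ∀ i k, (P i k).IsHermitian)
    (hΩ : ∀ i, (Ω i).IsSymm) (p : (i : Fin n) → Fin (out i) → ℝ)
    {R Δ : Matrix (Fin q) (Fin q) ℂ} (hR : R.IsHermitian) (hΔ : Δ.IsHermitian)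
    (hΔ0 : Δ.trace = 0) {c : ℂ} (hc : kernelGramOf out P Ω R = kernelDataOf out P Ω p + c • 1) :
    kernelLossOf out P Ω p (R + Δ) =
      kernelLossOf out P Ω p R + n * ((kernelGramOf out P Ω Δ * Δ).trace).re := by
  have hn0 : (n : ℝ) ≠ 0 := by positivity
  have hcross : kernelForm Ω (outcomeRe P R) (outcomeRe P Δ) =
      kernelForm Ω p (outcomeRe P Δ) := by
    have h := trace_kernelGramOf_mul (Ω := Ω) hP hR hΔ
    rw [hc, add_mul, trace_add, trace_kernelDataOf_mul hP p hΔ, smul_mul_assoc, one_mul,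
      trace_smul, hΔ0, smul_zero, add_zero] at h
    exact (mul_left_cancel₀ (inv_ne_zero hn0) (Complex.ofReal_injective h)).symm
  have hsplit : outcomeRe P (R + Δ) - p = (outcomeRe P R - p) + outcomeRe P Δ := by
    rw [outcomeRe_add]
    abel
  rw [kernelLossOf_eq, kernelLossOf_eq, hsplit, kernelForm_add_left, kernelForm_add_right,
    kernelForm_add_right, kernelForm_comm hΩ (outcomeRe P Δ),
    kernelForm_sub_left _ p (outcomeRe P Δ), hcross, trace_kernelGramOf_mul hP hΔ hΔ,
    Complex.ofReal_re, mul_inv_cancel_left₀ hn0]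
  ring

end Gram

/-- **QUARK estimator.** For a complete design and symmetric positive definite
kernel Gram matrices `Ω_i`, the kernel Gram superoperator `H_K` is a self-adjoint positive
definite (hence invertible) operator on Hermitian matrices, `tr(H_K⁻¹(I_q)) > 0`, and the
unique minimizer of the kernel loss over trace-one Hermitian matrices is
`ρ̂ = H_K⁻¹(P_K) + (1 − tr(H_K⁻¹(P_K))) H_K⁻¹(I_q)/tr(H_K⁻¹(I_q))`. -/
theorem quark_estimator
    (q n : ℕ) (hq : 2 ≤ q) (hn : 1 ≤ n)
    (out : Fin n → ℕ) (hout : ∀ i, 2 ≤ out i)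
    (P : (i : Fin n) → Fin (out i) → Matrix (Fin q) (Fin q) ℂ)
    (hherm : ∀ i k, (P i k).IsHermitian)
    (hproj : ∀ i k, P i k * P i k = P i k)
    (horth : ∀ i (k k' : Fin (out i)), k ≠ k' → P i k * P i k' = 0)
    (hsum : ∀ i, ∑ k, P i k = 1)
    (hP0 : ∀ i k, P i k ≠ 0)
    (hcomplete : ∀ Δ : Matrix (Fin q) (Fin q) ℂ, Δ.IsHermitian → Δ.trace = 0 →
        (∀ i k, (Δ * P i k).trace = 0) → Δ = 0)
    (Ω : (i : Fin n) → Matrix (Fin (out i)) (Fin (out i)) ℝ)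
    (hΩsym : ∀ i, (Ω i).IsSymm) (hΩpd : ∀ i, (Ω i).PosDef)
    (p : (i : Fin n) → Fin (out i) → ℝ) :
    -- H_K is self-adjoint w.r.t. the Frobenius inner product
    (∀ S T : Matrix (Fin q) (Fin q) ℂ, S.IsHermitian → T.IsHermitian →
      (kernelGramOf out P Ω S * T).trace = (S * kernelGramOf out P Ω T).trace)
    ∧
    -- H_K is positive definite on Hermitian matrices
    (∀ S : Matrix (Fin q) (Fin q) ℂ, S.IsHermitian → S ≠ 0 →
      0 < ((kernelGramOf out P Ω S * S).trace).re)
    ∧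
    -- hence invertible: H_K⁻¹(P_K) and H_K⁻¹(I_q) exist (uniquely) among Hermitian matrices
    ((∃ A : Matrix (Fin q) (Fin q) ℂ, A.IsHermitian ∧
        kernelGramOf out P Ω A = kernelDataOf out P Ω p)
      ∧
     (∃ B : Matrix (Fin q) (Fin q) ℂ, B.IsHermitian ∧
        kernelGramOf out P Ω B = (1 : Matrix (Fin q) (Fin q) ℂ)))
    ∧
    -- and the QUARK estimator built from them is the unique minimizer of the kernel loss
    (∀ A B : Matrix (Fin q) (Fin q) ℂ, A.IsHermitian → B.IsHermitian →
      kernelGramOf out P Ω A = kernelDataOf out P Ω p →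
      kernelGramOf out P Ω B = (1 : Matrix (Fin q) (Fin q) ℂ) →
      0 < B.trace.re ∧
      (A + (((1 : ℂ) - A.trace) / B.trace) • B).IsHermitian ∧
      (A + (((1 : ℂ) - A.trace) / B.trace) • B).trace = 1 ∧
      (∀ T : Matrix (Fin q) (Fin q) ℂ, T.IsHermitian → T.trace = 1 →
        kernelLossOf out P Ω p (A + (((1 : ℂ) - A.trace) / B.trace) • B)
          ≤ kernelLossOf out P Ω p T) ∧
      (∀ T : Matrix (Fin q) (Fin q) ℂ, T.IsHermitian → T.trace = 1 →
        (∀ T' : Matrix (Fin q) (Fin q) ℂ, T'.IsHermitian → T'.trace = 1 →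
          kernelLossOf out P Ω p T ≤ kernelLossOf out P Ω p T') →
        T = A + (((1 : ℂ) - A.trace) / B.trace) • B)) := by
  have hpos (S : Matrix (Fin q) (Fin q) ℂ) (hS : S.IsHermitian) (hS0 : S ≠ 0) :=
    re_trace_kernelGramOf_mul_self_pos hn hherm hsum hcomplete hΩpd hS hS0
  refine ⟨fun S T hS hT => ?_, hpos,
    ⟨exists_isHermitian_kernelGramOf_eq hherm hpos (kernelDataOf_isHermitian hherm p),
      exists_isHermitian_kernelGramOf_eq hherm hpos isHermitian_one⟩,
    fun A B hA hB hgA hgB => ?_⟩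
  · rw [trace_mul_comm S, trace_kernelGramOf_mul hherm hS hT, trace_kernelGramOf_mul hherm hT hS,
      kernelForm_comm hΩsym]
  have : NeZero q := ⟨by omega⟩
  have hB0 : B ≠ 0 := by
    rintro rfl
    rw [← kernelGramLinear_apply, map_zero] at hgB
    exact zero_ne_one hgB
  have hBpos : 0 < B.trace.re := by
    simpa [hgB] using hpos B hB hB0
  have hBtr : B.trace ≠ 0 := fun h => by simp [h] at hBpos
  set c : ℂ := ((1 : ℂ) - A.trace) / B.trace with hc
  set R := A + c • B with hR
  have hRh : R.IsHermitian := by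
    refine hA.add ?_
    rw [IsHermitian, conjTranspose_smul, hB.eq, hc, star_div₀, star_sub, star_one,
      ← trace_conjTranspose, ← trace_conjTranspose, hA.eq, hB.eq]
  have hRtr : R.trace = 1 := by
    rw [hR, trace_add, trace_smul, smul_eq_mul, hc, div_mul_cancel₀ _ hBtr]
    ring
  have hgR : kernelGramOf out P Ω R = kernelDataOf out P Ω p + c • 1 := by
    rw [← hgA, ← hgB]
    simp only [← kernelGramLinear_apply, hR, map_add, map_smul]
  have hloss (T : Matrix (Fin q) (Fin q) ℂ) (hT : T.IsHermitian) (hT1 : T.trace = 1) :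
      kernelLossOf out P Ω p T = kernelLossOf out P Ω p R +
        n * ((kernelGramOf out P Ω (T - R) * (T - R)).trace).re := by
    have h := kernelLossOf_add hn hherm hΩsym p hRh (hT.sub hRh)
      (by rw [trace_sub, hT1, hRtr, sub_self]) hgR
    rwa [add_sub_cancel] at h
  have hlt (T : Matrix (Fin q) (Fin q) ℂ) (hT : T.IsHermitian) (hT1 : T.trace = 1)
      (hne : T ≠ R) : kernelLossOf out P Ω p R < kernelLossOf out P Ω p T := by
    rw [hloss T hT hT1]
    exact lt_add_of_pos_right _
      (mul_pos (by positivity) (hpos _ (hT.sub hRh) (sub_ne_zero.mpr hne)))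
  refine ⟨hBpos, hRh, hRtr, fun T hT hT1 => ?_, fun T hT hT1 hmin => ?_⟩
  · rcases eq_or_ne T R with rfl | hne
    · exact le_rfl
    · exact (hlt T hT hT1 hne).le
  · by_contra hne
    exact (hlt T hT hT1 hne).not_ge (hmin R hRh hRtr)
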